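/- Let 𝐢 be a dominant word with canonical factorization 𝐢 = 𝐢₁^{n₁}⋯𝐢_d^{n_d}, where 𝐢₁ ≻ ⋯ ≻ 𝐢_d are dominant Lyndon words and n₁,…,n_d are positive integers. Then 𝐢_d^{⋄n_d} ⋄ ⋯ ⋄ 𝐢₁^{⋄n₁} = ((−1)^{ξ(𝐢)} q^{−s(𝐢)} ∏_{k=1}^d [n_k]_{𝐢_k}!) · 𝐢 + Σ_{𝐤 ≺ 𝐢} a_𝐤 𝐤 for some coefficients a_𝐤 ∈ ℤ[q,q^{−1}]; in particular max of the left-hand side is 𝐢 and its leading coefficient is (−1)^{ξ(𝐢)} q^{−s(𝐢)} ∏_k [n_k]_{𝐢_k}!. -/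

import Mathlib

namespace SpinQHA

/-- The coefficient field `ℚ(q)`. -/
abbrev Kq : Type := RatFunc ℚ

/-- The variable `q`. -/
noncomputable def qX : Kq := RatFunc.X

/-- Parity of the letter `i`.  The alphabet is `Fin (n+2)` (so the rank is `n+2 ≥ 2`);
the index `i` represents the letter `i+1`, and the last letter is the unique odd one. -/
def pa (n : ℕ) (i : Fin (n+2)) : ℕ := if (i : ℕ) = n+1 then 1 else 0

/-- Symmetrized Cartan matrix of `osp(1|2(n+2))`. -/
def cart (n : ℕ) (i j : Fin (n+2)) : ℤ :=
  if i = j then (if (i : ℕ) = n+1 then 2 else 4)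
  else if (i : ℕ) + 1 = (j : ℕ) ∨ (j : ℕ) + 1 = (i : ℕ) then -2 else 0

/-- Bilinear form on `Q⁺` (elements recorded by their coordinates). -/
def bil (n : ℕ) (μ ν : Fin (n+2) → ℕ) : ℤ :=
  ∑ i, ∑ j, (μ i : ℤ) * (ν j : ℤ) * cart n i j

/-- Weight `|w| ∈ Q⁺` of a word. -/
def wt (n : ℕ) (w : List (Fin (n+2))) : Fin (n+2) → ℕ := fun i => w.count i

/-- Parity (as a natural number, read mod 2) of a word. -/
def pw (n : ℕ) (w : List (Fin (n+2))) : ℕ := (w.map (pa n)).sum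

/-- `F`, the free `ℚ(q)`-module on the set of words. -/
abbrev F (n : ℕ) : Type := List (Fin (n+2)) →₀ Kq

/-- Quantum shuffle of two words, computed in the "reversed" representation where the
head of each list is the *last* letter of the corresponding word; this encodes the
inductive rule `(xi) ⋄ (yj) = (x ⋄ (yj))i + (-1)^{p(xi)p(j)} q^{-(|xi|,|j|)} ((xi) ⋄ y)j`. -/
noncomputable def shAux (n : ℕ) : List (Fin (n+2)) → List (Fin (n+2)) → F n
  | [], y => Finsupp.single y 1
  | x, [] => Finsupp.single x 1
  | i :: x, j :: y =>
      Finsupp.mapDomain (List.cons i) (shAux n x (j :: y))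
      + ((-1 : Kq) ^ (pw n (i :: x) * pa n j)
          * qX ^ (-(bil n (wt n (i :: x)) (wt n [j])))) •
          Finsupp.mapDomain (List.cons j) (shAux n (i :: x) y)
  termination_by x y => x.length + y.length

/-- Quantum shuffle product of two words. -/
noncomputable def shw (n : ℕ) (x y : List (Fin (n+2))) : F n :=
  Finsupp.mapDomain List.reverse (shAux n x.reverse y.reverse)

/-- The quantum shuffle product `⋄` on `F`, extended bilinearly. -/
noncomputable def diam (n : ℕ) (u v : F n) : F n :=
  u.sum fun x cx => v.sum fun y cy => (cx * cy) • shw n x y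

/-- Strict lexicographic order `≺` on words. -/
def wlt (n : ℕ) (v w : List (Fin (n+2))) : Prop := List.Lex (· < ·) v w

/-- A word is Lyndon if it is nonempty and lexicographically smaller than each of its
proper nonempty suffixes. -/
def IsLyndonW (n : ℕ) (w : List (Fin (n+2))) : Prop :=
  w ≠ [] ∧ ∀ s t : List (Fin (n+2)), w = s ++ t → s ≠ [] → t ≠ [] → wlt n w t

/-- Iterated shuffle products of one-letter words. -/
noncomputable def prodLetters (n : ℕ) : List (Fin (n+2)) → F n
  | [] => Finsupp.single [] 1
  | i :: l => diam n (Finsupp.single [i] 1) (prodLetters n l)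

/-- `U`, the subalgebra of `(F,⋄)` generated by the one-letter words, realized as the
`ℚ(q)`-span of all iterated shuffle products of letters. -/
noncomputable def Ualg (n : ℕ) : Submodule Kq (F n) :=
  Submodule.span Kq (Set.range (prodLetters n))

/-- `w = max(u)`: `w` is the lexicographically largest word occurring in `u` with
nonzero coefficient. -/
def IsMaxWord (n : ℕ) (u : F n) (w : List (Fin (n+2))) : Prop :=
  w ∈ u.support ∧ ∀ v ∈ u.support, v = w ∨ wlt n v w

/-- A word is dominant if it is the largest word of some `u ∈ U`. -/
def IsDominant (n : ℕ) (w : List (Fin (n+2))) : Prop :=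
  ∃ u ∈ Ualg n, IsMaxWord n u w

/-- The `m`-fold concatenation `w^m` of a word. -/
def rep (n : ℕ) (m : ℕ) (w : List (Fin (n+2))) : List (Fin (n+2)) :=
  (List.replicate m w).flatten

/-- `q_𝐢 = q^{(|𝐢|,|𝐢|)/2}`. -/
noncomputable def qI (n : ℕ) (w : List (Fin (n+2))) : Kq :=
  qX ^ ((bil n (wt n w) (wt n w)) / 2)

/-- The (signed) quantum integer `[m]_𝐢`:
`[m]_𝐢 = (q_𝐢^m - q_𝐢^{-m})/(q_𝐢 - q_𝐢^{-1})` if `p(𝐢) = 0̄`, and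
`[m]_𝐢 = ((-q_𝐢)^m - q_𝐢^{-m})/(-q_𝐢 - q_𝐢^{-1})` if `p(𝐢) = 1̄`. -/
noncomputable def qint (n : ℕ) (w : List (Fin (n+2))) (m : ℕ) : Kq :=
  if pw n w % 2 = 0 then
    (qI n w ^ m - (qI n w)⁻¹ ^ m) / (qI n w - (qI n w)⁻¹)
  else
    ((-qI n w) ^ m - (qI n w)⁻¹ ^ m) / (-qI n w - (qI n w)⁻¹)

/-- The quantum factorial `[m]_𝐢! = [m]_𝐢 [m-1]_𝐢 ⋯ [1]_𝐢`. -/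
noncomputable def qfact (n : ℕ) (w : List (Fin (n+2))) : ℕ → Kq
  | 0 => 1
  | m + 1 => qint n w (m+1) * qfact n w m

/-- The `m`-fold quantum shuffle power `w^{⋄m}` of a word. -/
noncomputable def shPow (n : ℕ) (w : List (Fin (n+2))) : ℕ → F n
  | 0 => Finsupp.single [] 1
  | m + 1 => diam n (shPow n w m) (Finsupp.single w 1)

/-- The iterated shuffle product `𝐢_d^{⋄n_d} ⋄ ⋯ ⋄ 𝐢₁^{⋄n₁}` attached to a canonical
factorization, recorded as a list `fs = [(𝐢₁,n₁),…,(𝐢_d,n_d)]`. -/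
noncomputable def bigSh (n : ℕ) : List (List (Fin (n+2)) × ℕ) → F n
  | [] => Finsupp.single [] 1
  | p :: rest => diam n (bigSh n rest) (shPow n p.1 p.2)

/-- The word `𝐢 = 𝐢₁^{n₁} ⋯ 𝐢_d^{n_d}` of a canonical factorization. -/
def wordOfFac (n : ℕ) (fs : List (List (Fin (n+2)) × ℕ)) : List (Fin (n+2)) :=
  (fs.map (fun p => rep n p.2 p.1)).flatten

/-- `ξ(𝐢) = Σ_k p(𝐢_k) n_k (n_k - 1)/2`. -/
def xiFac (n : ℕ) (fs : List (List (Fin (n+2)) × ℕ)) : ℕ :=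
  (fs.map (fun p => pw n p.1 * (p.2 * (p.2 - 1) / 2))).sum

/-- `s(𝐢) = Σ_k (|𝐢_k|,|𝐢_k|) n_k (n_k - 1)/4`. -/
def sFac (n : ℕ) (fs : List (List (Fin (n+2)) × ℕ)) : ℤ :=
  (fs.map (fun p => (bil n (wt n p.1) (wt n p.1) / 2) * ((p.2 * (p.2 - 1) / 2 : ℕ) : ℤ))).sum

/-- `∏_{k=1}^d [n_k]_{𝐢_k}!`. -/
noncomputable def facProd (n : ℕ) (fs : List (List (Fin (n+2)) × ℕ)) : Kq :=
  (fs.map (fun p => qfact n p.1 p.2)).prod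

/-- The subring `ℤ[q,q⁻¹]` of Laurent polynomials inside `ℚ(q)` (here realized as the
`ℚ`-subalgebra generated by `q` and `q⁻¹`; the bracketed coefficients of the statement
lie in it). -/
noncomputable def LaurentSub : Subalgebra ℚ Kq :=
  Algebra.adjoin ℚ {RatFunc.X, (RatFunc.X)⁻¹}

section Shuffle

variable {α : Type*}

/-- `Shuf x y z`: the word `z` is a shuffle of `x` and `y`. -/
inductive Shuf : List α → List α → List α → Prop
  | nil : Shuf [] [] []
  | left {i : α} {x y z : List α} : Shuf x y z → Shuf (i :: x) y (i :: z)
  | right {j : α} {x y z : List α} : Shuf x y z → Shuf x (j :: y) (j :: z)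

theorem Shuf.symm {x y z : List α} (h : Shuf x y z) : Shuf y x z := by
  induction h with
  | nil => exact .nil
  | left _ ih => exact ih.right
  | right _ ih => exact ih.left

theorem Shuf.append (x y : List α) : Shuf x y (x ++ y) := by
  induction x with
  | nil =>
    induction y with
    | nil => exact .nil
    | cons j y ih => exact ih.right
  | cons i x ih => exact ih.left

theorem Shuf.length_eq {x y z : List α} (h : Shuf x y z) :
    z.length = x.length + y.length := by
  induction h with
  | nil => rfl
  | left _ ih => simp only [List.length_cons, ih]; omega
  | right _ ih => simp only [List.length_cons, ih]; omega

end Shuffle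

section Lyndon

variable {α : Type*} [LinearOrder α]

/-- Lyndon words over an arbitrary linearly ordered alphabet. -/
def IsLyndon (w : List α) : Prop :=
  w ≠ [] ∧ ∀ s t : List α, w = s ++ t → s ≠ [] → t ≠ [] → w < t

/-- Non-increasing lists of Lyndon words. -/
def IsCanonical (L : List (List α)) : Prop :=
  (∀ l ∈ L, IsLyndon l) ∧ L.Pairwise (· ≥ ·)

theorem Shuf.exists_lt {x y z : List α} (h : Shuf x y z) :
    ∀ {x' : List α}, x'.length = x.length → x < x' → ∃ z', Shuf x' y z' ∧ z < z' := by
  induction h with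
  | nil => intro x' hl hx; simp_all
  | @left i x y z h ih =>
    intro x' hl hx
    cases x' with
    | nil => simp at hl
    | cons k x' =>
      rcases List.cons_lt_cons_iff.1 hx with hik | ⟨rfl, hxx⟩
      · exact ⟨_, (Shuf.append x' y).left, List.cons_lt_cons_iff.2 (.inl hik)⟩
      · obtain ⟨z', hz', hlt⟩ := ih (by simpa using hl) hxx
        exact ⟨_, hz'.left, List.cons_lt_cons_iff.2 (.inr ⟨rfl, hlt⟩)⟩
  | @right j x y z h ih =>
    intro x' hl hx
    obtain ⟨z', hz', hlt⟩ := ih hl hx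
    exact ⟨_, hz'.right, List.cons_lt_cons_iff.2 (.inr ⟨rfl, hlt⟩)⟩

theorem Shuf.exists_le {x y z x' y' : List α} (h : Shuf x y z) (hx : x ≤ x') (hy : y ≤ y')
    (hlx : x'.length = x.length) (hly : y'.length = y.length) :
    ∃ z', Shuf x' y' z' ∧ z ≤ z' ∧ (x ≠ x' ∨ y ≠ y' → z < z') := by
  obtain ⟨z₁, h₁, hz₁, hs₁⟩ : ∃ z₁, Shuf x' y z₁ ∧ z ≤ z₁ ∧ (x ≠ x' → z < z₁) := by
    rcases hx.eq_or_lt with rfl | hx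
    · exact ⟨z, h, le_rfl, fun h => absurd rfl h⟩
    · obtain ⟨z', hz', hlt⟩ := h.exists_lt hlx hx
      exact ⟨z', hz', hlt.le, fun _ => hlt⟩
  rcases hy.eq_or_lt with rfl | hy
  · exact ⟨z₁, h₁, hz₁, fun h => hs₁ (h.resolve_right fun h => h rfl)⟩
  · obtain ⟨z', hz', hlt⟩ := h₁.symm.exists_lt hly hy
    exact ⟨z', hz'.symm, (hz₁.trans_lt hlt).le, fun _ => hz₁.trans_lt hlt⟩

theorem lt_append_or_prefix {a b : List α} (h : a < b) :
    (∀ x y, a ++ x < b ++ y) ∨ ∃ e, e ≠ [] ∧ b = a ++ e := by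
  induction a generalizing b with
  | nil => exact .inr ⟨b, by rintro rfl; simp at h, rfl⟩
  | cons i a ih =>
    cases b with
    | nil => simp at h
    | cons j b =>
      rcases List.cons_lt_cons_iff.1 h with hij | ⟨rfl, hab⟩
      · exact .inl fun x y => List.cons_lt_cons_iff.2 (.inl hij)
      · rcases ih hab with hs | ⟨e, he, rfl⟩
        · exact .inl fun x y => List.cons_lt_cons_iff.2 (.inr ⟨rfl, hs x y⟩)
        · exact .inr ⟨e, he, rfl⟩

theorem append_le_append_left_iff {a b c : List α} : a ++ b ≤ a ++ c ↔ b ≤ c := by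
  constructor
  · intro h
    by_contra hn
    exact absurd h (not_le.2 (List.append_left_lt (not_le.1 hn)))
  · intro h
    rcases h.eq_or_lt with rfl | h
    · exact le_rfl
    · exact (List.append_left_lt h).le

theorem nil_le_word (l : List α) : ([] : List α) ≤ l :=
  not_lt.1 (List.not_lt_nil l)

theorem exists_min_suffix (w : List α) (hw : w ≠ []) :
    ∃ s, s ≠ [] ∧ s <:+ w ∧ ∀ u, u ≠ [] → u <:+ w → s ≤ u := by
  induction w with
  | nil => exact absurd rfl hw
  | cons a w ih =>
    by_cases hw' : w = []
    · subst hw'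
      refine ⟨[a], by simp, List.suffix_rfl, fun u hu hs => ?_⟩
      rcases List.suffix_cons_iff.1 hs with rfl | h
      · exact le_rfl
      · exact absurd (List.suffix_nil.1 h) hu
    · obtain ⟨s, hs, hsw, hmin⟩ := ih hw'
      rcases le_total s (a :: w) with h | h
      · refine ⟨s, hs, hsw.trans (List.suffix_cons a w), fun u hu hsu => ?_⟩
        rcases List.suffix_cons_iff.1 hsu with rfl | h'
        · exact h
        · exact hmin u hu h'
      · refine ⟨a :: w, by simp, List.suffix_rfl, fun u hu hsu => ?_⟩
        rcases List.suffix_cons_iff.1 hsu with rfl | h'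
        · exact le_rfl
        · exact h.trans (hmin u hu h')

theorem IsCanonical.nil : IsCanonical ([] : List (List α)) := ⟨by simp, by simp⟩

theorem isCanonical_append {A B : List (List α)} :
    IsCanonical (A ++ B) ↔ IsCanonical A ∧ IsCanonical B ∧ ∀ a ∈ A, ∀ b ∈ B, a ≥ b := by
  simp only [IsCanonical, List.pairwise_append, List.mem_append, or_imp, forall_and]
  tauto

theorem isCanonical_cons {a : List α} {B : List (List α)} :
    IsCanonical (a :: B) ↔ IsLyndon a ∧ IsCanonical B ∧ ∀ b ∈ B, a ≥ b := by
  simp only [IsCanonical, List.pairwise_cons, List.mem_cons, forall_eq_or_imp]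
  tauto

theorem IsCanonical.eq_of_perm {A B : List (List α)} (hA : IsCanonical A) (hB : IsCanonical B)
    (h : A.Perm B) : A = B :=
  List.Perm.eq_of_pairwise (fun _ _ _ _ h₁ h₂ => le_antisymm h₂ h₁) hA.2 hB.2 h

theorem exists_isCanonical_perm (A : List (List α)) (hA : ∀ a ∈ A, IsLyndon a) :
    ∃ C, IsCanonical C ∧ C.Perm A :=
  ⟨A.insertionSort (· ≥ ·), ⟨fun l hl => hA l (by simpa using hl),
    List.pairwise_insertionSort _ _⟩, List.perm_insertionSort _ _⟩

theorem exists_isCanonical_flatten (w : List α) : ∃ D, IsCanonical D ∧ D.flatten = w := by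
  induction hn : w.length using Nat.strong_induction_on generalizing w with
  | _ N ih =>
    by_cases hw : w = []
    · exact ⟨[], .nil, by simp [hw]⟩
    obtain ⟨s, hs, ⟨t, rfl⟩, hmin⟩ := exists_min_suffix w hw
    have hpos : 0 < s.length := List.length_pos_of_ne_nil hs
    obtain ⟨D, hD, rfl⟩ := ih t.length (by simp at hn; omega) t rfl
    refine ⟨D ++ [s], isCanonical_append.2 ⟨hD, isCanonical_cons.2 ⟨⟨hs, ?_⟩, .nil, by simp⟩, ?_⟩,
      by simp⟩
    · rintro a b rfl ha hb
      refine lt_of_le_of_ne (hmin b hb (by simp [← List.append_assoc])) fun h => ha ?_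
      simpa using congrArg List.length h
    · rcases List.eq_nil_or_concat' D with rfl | ⟨D₀, x, rfl⟩
      · simp
      have hx : s ≤ x := by
        have hxs : s ≤ x ++ s := hmin _ (by simp [hs]) ⟨D₀.flatten, by simp⟩
        have hxne : x ≠ [] := (hD.1 x (by simp)).1
        by_contra hlt
        rcases lt_append_or_prefix (not_le.1 hlt) with h | ⟨e, he, rfl⟩
        · exact absurd hxs (not_le.2 (by simpa using h s []))
        · have h₁ : e ≤ x ++ e := append_le_append_left_iff.1 hxs
          have h₂ : x ++ e ≤ e := hmin e he (by simp [← List.append_assoc])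
          exact hxne (by simpa using congrArg List.length (le_antisymm h₁ h₂))
      intro a ha b hb
      obtain rfl : b = s := by simpa using hb
      rcases List.mem_append.1 ha with ha | ha
      · exact hx.trans ((isCanonical_append.1 hD).2.2 a ha x (by simp))
      · obtain rfl : a = x := by simpa using ha
        exact hx

theorem IsLyndon.lt_of_mem_tail {i : α} {m : List α} {D : List (List α)}
    (hm : IsLyndon (i :: m)) (hD : IsCanonical D) (hDm : D.flatten = m) :
    ∀ d ∈ D, i :: m < d := by
  rcases List.eq_nil_or_concat' D with rfl | ⟨D₀, x, rfl⟩
  · simp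
  have hx : i :: m < x := hm.2 (i :: D₀.flatten) x (by simp [← hDm]) (by simp)
    (hD.1 x (by simp)).1
  intro d hd
  rcases List.mem_append.1 hd with hd | hd
  · exact hx.trans_le ((isCanonical_append.1 hD).2.2 d hd x (by simp))
  · obtain rfl : d = x := by simpa using hd
    exact hx

/-- Removing the first letter of a canonical factorization splits its first factor. -/
theorem IsCanonical.exists_tail {i : α} {x : List α} {A : List (List α)} (hA : IsCanonical A)
    (h : A.flatten = i :: x) : ∃ m A' D, A = (i :: m) :: A' ∧ IsLyndon (i :: m) ∧ IsCanonical D ∧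
      D.flatten = m ∧ IsCanonical (D ++ A') ∧ (D ++ A').flatten = x ∧ ∀ d ∈ D, i :: m < d := by
  cases A with
  | nil => simp at h
  | cons m A' =>
    obtain ⟨hm, hA', hle⟩ := isCanonical_cons.1 hA
    cases m with
    | nil => exact absurd rfl hm.1
    | cons j m =>
      simp only [List.flatten_cons, List.cons_append, List.cons.injEq] at h
      obtain ⟨rfl, rfl⟩ := h
      obtain ⟨D, hD, hDm⟩ := exists_isCanonical_flatten m
      have hlt := hm.lt_of_mem_tail hD hDm
      exact ⟨m, A', D, rfl, hm, hD, hDm, isCanonical_append.2 ⟨hD, hA', fun a ha b hb =>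
        (hle b hb).trans (hlt a ha).le⟩, by simp [hDm], hlt⟩

theorem exists_split_at (v : List α) {D : List (List α)} (hD : D.Pairwise (· ≥ ·)) :
    ∃ P Q, D = P ++ Q ∧ (∀ p ∈ P, v < p) ∧ ∀ p ∈ Q, p ≤ v := by
  induction D with
  | nil => exact ⟨[], [], by simp⟩
  | cons d D ih =>
    obtain ⟨hd, hD⟩ := List.pairwise_cons.1 hD
    by_cases h : v < d
    · obtain ⟨P, Q, rfl, hP, hQ⟩ := ih hD
      exact ⟨d :: P, Q, rfl, by simpa [h] using hP, hQ⟩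
    · refine ⟨[], d :: D, rfl, by simp, ?_⟩
      have h := not_lt.1 h
      simpa [h] using fun a ha => (hd a ha).le.trans h

theorem cons_flatten_lt {i : α} {m v : List α} {C C' D N : List (List α)}
    (hD : IsCanonical D) (hDm : D.flatten = m)
    (hC : IsCanonical (v :: C)) (hC' : IsCanonical C') (p : (v :: C).Perm ((i :: m) :: N))
    (p' : C'.Perm (D ++ N)) (hlt : i :: m < v) :
    i :: C'.flatten < (v :: C).flatten := by
  have hN : ∀ l ∈ N, IsLyndon l ∧ l ≤ v := fun l hl => by
    have hl' : l ∈ v :: C := p.mem_iff.2 (by simp [hl])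
    refine ⟨hC.1 l hl', ?_⟩
    rcases List.mem_cons.1 hl' with rfl | h
    · exact le_rfl
    · exact (isCanonical_cons.1 hC).2.2 l h
  have hvN : v ∈ N := by
    rcases List.mem_cons.1 (p.mem_iff.1 (List.mem_cons_self (a := v) (l := C))) with h | h
    · exact absurd h hlt.ne'
    · exact h
  have hv : IsLyndon v := (hN v hvN).1
  obtain ⟨P, Q, rfl, hP, hQ⟩ := exists_split_at v hD.2
  obtain ⟨hcP, hcQ, -⟩ := isCanonical_append.1 hD
  obtain ⟨R, hR, hRp⟩ := exists_isCanonical_perm (Q ++ N.erase v) (by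
    intro a ha
    rcases List.mem_append.1 ha with ha | ha
    · exact hcQ.1 a ha
    · exact (hN a (List.mem_of_mem_erase ha)).1)
  have hRv : ∀ r ∈ R, v ≥ r := fun r hr => by
    rcases List.mem_append.1 (hRp.mem_iff.1 hr) with h | h
    · exact hQ r h
    · exact (hN r (List.mem_of_mem_erase h)).2
  obtain rfl : C' = P ++ v :: R := by
    refine hC'.eq_of_perm (isCanonical_append.2 ⟨hcP, isCanonical_cons.2 ⟨hv, hR, hRv⟩, ?_⟩) ?_
    · intro a ha b hb
      rcases List.mem_cons.1 hb with rfl | hb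
      · exact (hP a ha).le
      · exact (hRv b hb).trans (hP a ha).le
    · refine p'.trans ?_
      rw [List.append_assoc]
      refine List.Perm.append_left P ?_
      refine (List.Perm.append_left Q (List.perm_cons_erase hvN)).trans ?_
      exact List.perm_middle.trans (hRp.symm.cons v)
  subst hDm
  have hlt' : i :: P.flatten < v := by
    refine lt_of_le_of_lt ?_ hlt
    simpa using (append_le_append_left_iff (a := i :: P.flatten)).2 (nil_le_word Q.flatten)
  rcases lt_append_or_prefix hlt' with h | ⟨e, he, hve⟩
  · simpa using h (v ++ R.flatten) C.flatten
  · have hev : v < e := hv.2 _ e hve (by simp) he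
    rcases lt_append_or_prefix hev with h | ⟨f, -, hf⟩
    · have := List.append_left_lt (l₁ := i :: P.flatten) (h R.flatten C.flatten)
      rw [List.flatten_cons]
      nth_rewrite 2 [hve]
      simpa using this
    · have h₁ := congrArg List.length hve
      have h₂ := congrArg List.length hf
      simp at h₁ h₂
      omega

theorem cons_flatten_le {i : α} {m : List α} {A D N C C' : List (List α)}
    (hA : IsCanonical (D ++ A)) (hDm : D.flatten = m)
    (hlt : ∀ d ∈ D, i :: m < d) (hC : IsCanonical C) (hC' : IsCanonical C')
    (p : C.Perm ((i :: m) :: N)) (p' : C'.Perm (D ++ N)) :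
    i :: C'.flatten ≤ C.flatten ∧ ((∃ v ∈ N, i :: m < v) → i :: C'.flatten < C.flatten) := by
  have hD := (isCanonical_append.1 hA).1
  cases C with
  | nil => simpa using p.length_eq
  | cons v C =>
    have hmv : i :: m ≤ v := by
      rcases List.mem_cons.1 (p.mem_iff.2 (List.mem_cons_self (a := i :: m) (l := N))) with h | h
      · exact h.le
      · exact (isCanonical_cons.1 hC).2.2 _ h
    rcases hmv.eq_or_lt with rfl | h
    · have pC : C.Perm N := (List.perm_cons _).1 p
      obtain ⟨-, hC₁, hle⟩ := isCanonical_cons.1 hC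
      obtain rfl : C' = D ++ C := by
        refine hC'.eq_of_perm (isCanonical_append.2 ⟨hD, hC₁, fun a ha b hb => ?_⟩)
          (p'.trans (pC.symm.append_left D))
        exact (hle b hb).trans (hlt a ha).le
      refine ⟨by simp [hDm], fun ⟨v, hv, hv'⟩ => absurd hv' (not_lt.2 ?_)⟩
      exact hle v (pC.mem_iff.2 hv)
    · have := cons_flatten_lt hD hDm hC hC' p p' h
      exact ⟨this.le, fun _ => this⟩

theorem Shuf.le_flatten {x y z : List α} (h : Shuf x y z) :
    ∀ {A B C : List (List α)}, IsCanonical A → IsCanonical B → IsCanonical C →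
      A.flatten = x → B.flatten = y → C.Perm (A ++ B) → z ≤ C.flatten := by
  have key : ∀ {i : α} {x y z : List α},
      (∀ {A B C : List (List α)}, IsCanonical A → IsCanonical B → IsCanonical C →
        A.flatten = x → B.flatten = y → C.Perm (A ++ B) → z ≤ C.flatten) →
      ∀ {A B C : List (List α)}, IsCanonical A → IsCanonical B → IsCanonical C →
        A.flatten = i :: x → B.flatten = y → C.Perm (A ++ B) → i :: z ≤ C.flatten := by
    intro i x y z ih A B C hA hB hC hx hy p
    obtain ⟨m, A', D, rfl, -, -, hDm, hDA, hf, hlt⟩ := hA.exists_tail hx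
    obtain ⟨C', hC', p'⟩ := exists_isCanonical_perm (D ++ A' ++ B) (by
      intro a ha
      rcases List.mem_append.1 ha with ha | ha
      · exact hDA.1 a ha
      · exact hB.1 a ha)
    have h₁ : i :: z ≤ i :: C'.flatten :=
      append_le_append_left_iff (a := [i]).2 (ih hDA hB hC' hf hy p')
    exact h₁.trans (cons_flatten_le hDA hDm hlt hC hC' p
      (by simpa [List.append_assoc] using p')).1
  induction h with
  | nil => intros; exact nil_le_word _
  | left _ ih => exact key ih
  | right _ ih =>
    intro A B C hA hB hC hx hy p
    exact key (fun hA hB hC hx hy p => ih hB hA hC hy hx (p.trans List.perm_append_comm))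
      hB hA hC hy hx (p.trans List.perm_append_comm)

theorem Shuf.cons_lt_flatten {i : α} {x y z a v : List α} {A B C : List (List α)}
    (h : Shuf x y z) (hA : IsCanonical (a :: A)) (hB : IsCanonical B) (hC : IsCanonical C)
    (hx : (a :: A).flatten = i :: x) (hy : B.flatten = y) (p : C.Perm (a :: A ++ B))
    (hv : v ∈ B) (hav : a < v) : i :: z < C.flatten := by
  obtain ⟨m, A', D, hAm, -, -, hDm, hDA, hf, hlt⟩ := hA.exists_tail hx
  obtain ⟨rfl, rfl⟩ := List.cons.inj hAm
  obtain ⟨C', hC', p'⟩ := exists_isCanonical_perm (D ++ A ++ B) (by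
    intro a ha
    rcases List.mem_append.1 ha with ha | ha
    · exact hDA.1 a ha
    · exact hB.1 a ha)
  have h₁ : i :: z ≤ i :: C'.flatten :=
    append_le_append_left_iff (a := [i]).2 (h.le_flatten hDA hB hC' hf hy p')
  exact h₁.trans_lt ((cons_flatten_le hDA hDm hlt hC hC' p
    (by simpa [List.append_assoc] using p')).2 ⟨v, by simp [hv], hav⟩)

end Lyndon

/-- The commutation factor `(-1)^{p(x)p(y)} q^{-(|x|,|y|)}` of two words. -/
noncomputable def chi (n : ℕ) (x y : List (Fin (n+2))) : Kq :=
  (-1 : Kq) ^ (pw n x * pw n y) * qX ^ (-(bil n (wt n x) (wt n y)))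

theorem qX_ne_zero : qX ≠ 0 := RatFunc.X_ne_zero

theorem pw_append (n : ℕ) (x y : List (Fin (n+2))) : pw n (x ++ y) = pw n x + pw n y := by
  simp [pw]

theorem bil_wt_append_left (n : ℕ) (x y : List (Fin (n+2))) (ν : Fin (n+2) → ℕ) :
    bil n (wt n (x ++ y)) ν = bil n (wt n x) ν + bil n (wt n y) ν := by
  simp only [bil, wt, List.count_append, Nat.cast_add, add_mul, Finset.sum_add_distrib]

theorem bil_wt_append_right (n : ℕ) (x y : List (Fin (n+2))) (μ : Fin (n+2) → ℕ) :
    bil n μ (wt n (x ++ y)) = bil n μ (wt n x) + bil n μ (wt n y) := by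
  simp only [bil, wt, List.count_append, Nat.cast_add, mul_add, add_mul, Finset.sum_add_distrib]

theorem chi_append_left (n : ℕ) (x x' y : List (Fin (n+2))) :
    chi n (x ++ x') y = chi n x y * chi n x' y := by
  simp only [chi, pw_append, bil_wt_append_left, add_mul, pow_add, neg_add,
    zpow_add₀ qX_ne_zero]
  ring

theorem chi_append_right (n : ℕ) (x y y' : List (Fin (n+2))) :
    chi n x (y ++ y') = chi n x y * chi n x y' := by
  simp only [chi, pw_append, bil_wt_append_right, mul_add, pow_add, neg_add,
    zpow_add₀ qX_ne_zero]
  ring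

theorem chi_cons_left (n : ℕ) (i : Fin (n+2)) (x y : List (Fin (n+2))) :
    chi n (i :: x) y = chi n [i] y * chi n x y :=
  chi_append_left n [i] x y

@[simp] theorem chi_nil_left (n : ℕ) (y : List (Fin (n+2))) : chi n [] y = 1 := by
  simp [chi, pw, bil, wt]

@[simp] theorem chi_nil_right (n : ℕ) (x : List (Fin (n+2))) : chi n x [] = 1 := by
  simp [chi, pw, bil, wt]

theorem chi_reverse_left (n : ℕ) (x y : List (Fin (n+2))) : chi n x.reverse y = chi n x y := by
  have h₁ : wt n x.reverse = wt n x := funext fun i => by simp [wt]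
  have h₂ : pw n x.reverse = pw n x := by simp [pw, List.sum_reverse]
  rw [chi, chi, h₁, h₂]

@[simp] theorem shw_nil_left (n : ℕ) (y : List (Fin (n+2))) :
    shw n [] y = Finsupp.single y 1 := by
  simp [shw, shAux]

@[simp] theorem shw_nil_right (n : ℕ) (x : List (Fin (n+2))) :
    shw n x [] = Finsupp.single x 1 := by
  have : ∀ x, shAux n x [] = Finsupp.single x 1 := fun x => by cases x <;> simp [shAux]
  simp [shw, this]

/-- Appending a letter on the left. -/
noncomputable def consMap (n : ℕ) (i : Fin (n+2)) : F n →ₗ[Kq] F n :=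
  Finsupp.lmapDomain Kq Kq (List.cons i)

/-- Appending a letter on the right. -/
noncomputable def snocMap (n : ℕ) (i : Fin (n+2)) : F n →ₗ[Kq] F n :=
  Finsupp.lmapDomain Kq Kq (fun w => w ++ [i])

@[simp] theorem consMap_single (n : ℕ) (i : Fin (n+2)) (x : List (Fin (n+2))) (c : Kq) :
    consMap n i (Finsupp.single x c) = Finsupp.single (i :: x) c := by
  simp [consMap]

@[simp] theorem snocMap_single (n : ℕ) (i : Fin (n+2)) (x : List (Fin (n+2))) (c : Kq) :
    snocMap n i (Finsupp.single x c) = Finsupp.single (x ++ [i]) c := by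
  simp [snocMap]

theorem snocMap_consMap (n : ℕ) (i j : Fin (n+2)) (u : F n) :
    snocMap n j (consMap n i u) = consMap n i (snocMap n j u) := by
  simp only [snocMap, consMap, Finsupp.lmapDomain_apply, ← Finsupp.mapDomain_comp]
  rfl

@[simp] theorem consMap_apply_nil (n : ℕ) (i : Fin (n+2)) (u : F n) : consMap n i u [] = 0 :=
  Finsupp.mapDomain_of_notMem_range _ _ (by simp)

theorem consMap_apply_cons (n : ℕ) (i k : Fin (n+2)) (u : F n) (z : List (Fin (n+2))) :
    consMap n i u (k :: z) = if i = k then u z else 0 := by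
  split_ifs with h
  · subst h
    exact Finsupp.mapDomain_apply (List.cons_injective) _ _
  · exact Finsupp.mapDomain_of_notMem_range _ _ (by simpa using h)

theorem shw_snoc_snoc (n : ℕ) (i j : Fin (n+2)) (x y : List (Fin (n+2))) :
    shw n (x ++ [i]) (y ++ [j]) = snocMap n i (shw n x (y ++ [j]))
      + chi n (x ++ [i]) [j] • snocMap n j (shw n (x ++ [i]) y) := by
  have h : ∀ (k : Fin (n+2)) (u : F n),
      Finsupp.mapDomain List.reverse (Finsupp.mapDomain (List.cons k) u)
        = snocMap n k (Finsupp.mapDomain List.reverse u) := fun k u => by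
    simp only [snocMap, Finsupp.lmapDomain_apply, ← Finsupp.mapDomain_comp]
    congr 1
    funext w
    simp
  have hc : chi n (x ++ [i]) [j] = (-1 : Kq) ^ (pw n (i :: x.reverse) * pa n j)
      * qX ^ (-(bil n (wt n (i :: x.reverse)) (wt n [j]))) := by
    rw [← chi_reverse_left, List.reverse_append]
    simp [chi, pw]
  simp only [shw, List.reverse_append, List.reverse_singleton, List.singleton_append]
  rw [shAux, Finsupp.mapDomain_add, Finsupp.mapDomain_smul, h, h, hc]

/-- The recursion for the quantum shuffle product on the first letters. -/
theorem shw_cons_cons (n : ℕ) (i j : Fin (n+2)) (x y : List (Fin (n+2))) :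
    shw n (i :: x) (j :: y) = chi n [i] (j :: y) • consMap n i (shw n x (j :: y))
      + consMap n j (shw n (i :: x) y) := by
  induction hN : x.length + y.length using Nat.strong_induction_on generalizing x y with
  | _ N ih =>
  rcases List.eq_nil_or_concat' x with rfl | ⟨x, a, rfl⟩ <;>
    rcases List.eq_nil_or_concat' y with rfl | ⟨y, b, rfl⟩
  · have h := shw_snoc_snoc n i j [] []
    simp only [List.nil_append, shw_nil_left, shw_nil_right, snocMap_single] at h
    simp [h, add_comm]
  · have h := shw_snoc_snoc n i b [] (j :: y)
    have h' := ih y.length (by simp at hN; omega) [] y (by simp)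
    simp only [List.nil_append, List.cons_append, shw_nil_left, snocMap_single] at h h' ⊢
    rw [h, h']
    have h'' := shw_snoc_snoc n i b [] y
    simp only [List.nil_append, shw_nil_left, snocMap_single] at h''
    rw [h'']
    simp only [map_add, map_smul, snocMap_consMap, snocMap_single, consMap_single, smul_add,
      smul_smul, List.cons_append]
    rw [show chi n [i] (j :: (y ++ [b])) = _ from chi_append_right n [i] (j :: y) [b],
      mul_comm (chi n [i] [b])]
    abel
  · have h := shw_snoc_snoc n a j (i :: x) []
    have h' := ih x.length (by simp at hN; omega) x [] (by simp)
    simp only [List.nil_append, List.cons_append, shw_nil_right, snocMap_single] at h h' ⊢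
    rw [h, h']
    have h'' := shw_snoc_snoc n a j x []
    simp only [List.nil_append, shw_nil_right, snocMap_single] at h''
    rw [h'']
    simp only [map_add, map_smul, snocMap_consMap, snocMap_single, consMap_single, smul_add,
      smul_smul, List.cons_append]
    rw [chi_cons_left n i (x ++ [a])]
    abel
  · have h := shw_snoc_snoc n a b (i :: x) (j :: y)
    have h₁ := ih _ (by simp at hN ⊢; omega) x (y ++ [b]) rfl
    have h₂ := ih _ (by simp at hN ⊢; omega) (x ++ [a]) y rfl
    simp only [List.cons_append] at h ⊢
    rw [h, h₁, h₂]
    have h₃ := shw_snoc_snoc n a b (i :: x) y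
    have h₄ := shw_snoc_snoc n a b x (j :: y)
    simp only [List.cons_append] at h₃ h₄
    rw [h₃, h₄]
    simp only [map_add, map_smul, snocMap_consMap, smul_add, smul_smul]
    rw [chi_cons_left n i (x ++ [a]),
      show chi n [i] (j :: (y ++ [b])) = _ from chi_append_right n [i] (j :: y) [b]]
    simp only [mul_comm, mul_assoc]
    abel

theorem Shuf.nil_left {α : Type*} (y : List α) : Shuf [] y y := Shuf.append [] y

theorem Shuf.nil_right {α : Type*} (x : List α) : Shuf x [] x := (Shuf.nil_left x).symm

theorem shw_ne_zero {n : ℕ} {x y z : List (Fin (n+2))} (h : shw n x y z ≠ 0) : Shuf x y z := by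
  induction hN : x.length + y.length using Nat.strong_induction_on generalizing x y z with
  | _ N ih =>
  cases x with
  | nil =>
    rw [shw_nil_left] at h
    obtain rfl := (Finsupp.single_apply_ne_zero.1 h).1
    exact .nil_left _
  | cons i x =>
    cases y with
    | nil =>
      rw [shw_nil_right] at h
      obtain rfl := (Finsupp.single_apply_ne_zero.1 h).1
      exact .nil_right _
    | cons j y =>
      rw [shw_cons_cons, Finsupp.add_apply, Finsupp.smul_apply] at h
      cases z with
      | nil => simp at h
      | cons k z =>
        rw [consMap_apply_cons, consMap_apply_cons] at h
        by_cases h₁ : i = k ∧ shw n x (j :: y) z ≠ 0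
        · obtain ⟨rfl, h₁⟩ := h₁
          exact (ih _ (by simp at hN ⊢; omega) h₁ rfl).left
        · by_cases h₂ : j = k ∧ shw n (i :: x) y z ≠ 0
          · obtain ⟨rfl, h₂⟩ := h₂
            exact (ih _ (by simp at hN ⊢; omega) h₂ rfl).right
          · refine absurd ?_ h
            simp only [not_and, not_not] at h₁ h₂
            simp +contextual [ite_eq_right_iff.2 h₁, ite_eq_right_iff.2 h₂]

theorem qX_zpow_mem (k : ℤ) : qX ^ k ∈ LaurentSub := by
  have h₁ : qX ∈ LaurentSub := Algebra.subset_adjoin (by simp [qX])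
  have h₂ : qX⁻¹ ∈ LaurentSub := Algebra.subset_adjoin (by simp [qX])
  rcases k with k | k
  · simpa using pow_mem h₁ k
  · simpa [zpow_negSucc] using pow_mem h₂ (k + 1)

theorem chi_mem (n : ℕ) (x y : List (Fin (n+2))) : chi n x y ∈ LaurentSub :=
  mul_mem (pow_mem (neg_mem (one_mem _)) _) (qX_zpow_mem _)

theorem single_one_mem (n : ℕ) (x z : List (Fin (n+2))) :
    (Finsupp.single x 1 : F n) z ∈ LaurentSub := by
  classical
  rw [Finsupp.single_apply]
  split_ifs
  · exact one_mem _
  · exact zero_mem _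

theorem consMap_mem (n : ℕ) (i : Fin (n+2)) {u : F n} (hu : ∀ w, u w ∈ LaurentSub)
    (w : List (Fin (n+2))) : consMap n i u w ∈ LaurentSub := by
  cases w with
  | nil => simp
  | cons k z =>
    rw [consMap_apply_cons]
    split_ifs
    · exact hu z
    · exact zero_mem _

theorem shw_mem (n : ℕ) (x y z : List (Fin (n+2))) : shw n x y z ∈ LaurentSub := by
  induction hN : x.length + y.length using Nat.strong_induction_on generalizing x y z with
  | _ N ih =>
  cases x with
  | nil => simpa using single_one_mem n y z
  | cons i x =>
    cases y with
    | nil => simpa using single_one_mem n (i :: x) z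
    | cons j y =>
      rw [shw_cons_cons, Finsupp.add_apply, Finsupp.smul_apply]
      refine add_mem (mul_mem (chi_mem n _ _) (consMap_mem n i (fun w => ?_) z))
        (consMap_mem n j (fun w => ?_) z)
      · exact ih _ (by simp at hN ⊢; omega) _ _ _ rfl
      · exact ih _ (by simp at hN ⊢; omega) _ _ _ rfl

theorem diam_apply (n : ℕ) (u v : F n) (z : List (Fin (n+2))) :
    diam n u v z = ∑ x ∈ u.support, ∑ y ∈ v.support, u x * v y * shw n x y z := by
  simp [diam, Finsupp.sum, Finsupp.finsetSum_apply]

theorem diam_mem {n : ℕ} {u v : F n} (hu : ∀ w, u w ∈ LaurentSub) (hv : ∀ w, v w ∈ LaurentSub)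
    (z : List (Fin (n+2))) : diam n u v z ∈ LaurentSub := by
  rw [diam_apply]
  exact sum_mem fun x _ => sum_mem fun y _ => mul_mem (mul_mem (hu x) (hv y)) (shw_mem n x y z)

theorem shPow_mem (n : ℕ) (w : List (Fin (n+2))) (m : ℕ) (z : List (Fin (n+2))) :
    shPow n w m z ∈ LaurentSub := by
  induction m generalizing z with
  | zero => exact single_one_mem n _ _
  | succ m ih => exact diam_mem ih (single_one_mem n w) z

theorem bigSh_mem (n : ℕ) (fs : List (List (Fin (n+2)) × ℕ)) (z : List (Fin (n+2))) :
    bigSh n fs z ∈ LaurentSub := by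
  induction fs generalizing z with
  | nil => exact single_one_mem n _ _
  | cons p fs ih => exact diam_mem ih (shPow_mem n _ _) z

/-- Every word occurring in `u` has the length of `a` and is at most `a`. -/
def BoundedBy (n : ℕ) (u : F n) (a : List (Fin (n+2))) : Prop :=
  ∀ w, u w ≠ 0 → w.length = a.length ∧ w ≤ a

theorem boundedBy_single (n : ℕ) (a : List (Fin (n+2))) :
    BoundedBy n (Finsupp.single a 1) a := by
  intro w hw
  obtain rfl := (Finsupp.single_apply_ne_zero.1 hw).1
  exact ⟨rfl, le_rfl⟩

theorem BoundedBy.diam {n : ℕ} {u v : F n} {a b T : List (Fin (n+2))} (hu : BoundedBy n u a)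
    (hv : BoundedBy n v b) (hT : ∀ z, Shuf a b z → z ≤ T)
    (hTl : T.length = a.length + b.length) :
    BoundedBy n (diam n u v) T ∧ diam n u v T = u a * v b * shw n a b T := by
  constructor
  · intro z hz
    rw [diam_apply] at hz
    obtain ⟨x, hx, hz⟩ := Finset.exists_ne_zero_of_sum_ne_zero hz
    obtain ⟨y, hy, hz⟩ := Finset.exists_ne_zero_of_sum_ne_zero hz
    obtain ⟨hxl, hxa⟩ := hu x (Finsupp.mem_support_iff.1 hx)
    obtain ⟨hyl, hyb⟩ := hv y (Finsupp.mem_support_iff.1 hy)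
    have hs := shw_ne_zero (right_ne_zero_of_mul hz)
    obtain ⟨z', hz', hle, -⟩ := hs.exists_le hxa hyb hxl.symm hyl.symm
    exact ⟨by rw [hs.length_eq, hTl, hxl, hyl], hle.trans (hT z' hz')⟩
  · have key : ∀ x y, u x ≠ 0 → v y ≠ 0 → x ≠ a ∨ y ≠ b → shw n x y T = 0 := by
      intro x y hx hy hne
      by_contra h
      obtain ⟨hxl, hxa⟩ := hu x hx
      obtain ⟨hyl, hyb⟩ := hv y hy
      obtain ⟨z', hz', -, hlt⟩ := (shw_ne_zero h).exists_le hxa hyb hxl.symm hyl.symm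
      exact absurd (hT z' hz') (not_le.2 (hlt hne))
    rw [diam_apply, Finset.sum_eq_single a, Finset.sum_eq_single b]
    · intro y hy hyb
      by_cases ha : u a = 0
      · simp [ha]
      · rw [key a y ha (Finsupp.mem_support_iff.1 hy) (.inr hyb), mul_zero]
    · intro h
      simp [Finsupp.notMem_support_iff.1 h]
    · intro x hx hxa
      refine Finset.sum_eq_zero fun y hy => ?_
      rw [key x y (Finsupp.mem_support_iff.1 hx) (Finsupp.mem_support_iff.1 hy) (.inl hxa),
        mul_zero]
    · intro h
      simp [Finsupp.notMem_support_iff.1 h]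

theorem IsCanonical.append_of_perm {α : Type*} [LinearOrder α] {A₁ A₂ B C : List (List α)}
    (hA : IsCanonical (A₁ ++ A₂)) (hC : IsCanonical C) (p : C.Perm (A₂ ++ B))
    (hlt : ∀ a ∈ A₁, ∀ b ∈ B, b < a) : IsCanonical (A₁ ++ C) := by
  obtain ⟨h₁, -, h₂⟩ := isCanonical_append.1 hA
  refine isCanonical_append.2 ⟨h₁, hC, fun a ha c hc => ?_⟩
  rcases List.mem_append.1 (p.mem_iff.1 hc) with hc | hc
  · exact h₂ a ha c hc
  · exact (hlt a ha c hc).le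

/-- Dominating Lyndon factors on the left of a shuffle must be read first. -/
theorem shw_flatten_left {n : ℕ} {A₁ A₂ B C : List (List (Fin (n+2)))}
    (hA : IsCanonical (A₁ ++ A₂)) (hB : IsCanonical B) (hC : IsCanonical C)
    (p : C.Perm (A₂ ++ B)) (hlt : ∀ a ∈ A₁, ∀ b ∈ B, b < a) :
    shw n (A₁ ++ A₂).flatten B.flatten (A₁ ++ C).flatten
      = chi n A₁.flatten B.flatten * shw n A₂.flatten B.flatten C.flatten := by
  induction hN : A₁.flatten.length using Nat.strong_induction_on generalizing A₁ with
  | _ N ih =>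
  cases A₁ with
  | nil => simp
  | cons m A₁ =>
    have hAC := hA.append_of_perm hC p hlt
    cases B with
    | nil =>
      obtain rfl : C = A₂ := hC.eq_of_perm (isCanonical_append.1 hA).2.1 (by simpa using p)
      simp
    | cons b B =>
      obtain ⟨hb, -, -⟩ := isCanonical_cons.1 hB
      obtain ⟨i, m, rfl⟩ := List.exists_cons_of_ne_nil (hA.1 m (by simp)).1
      obtain ⟨j, b, rfl⟩ := List.exists_cons_of_ne_nil hb.1
      have hf : ((i :: m) :: A₁ ++ A₂).flatten = i :: (m ++ (A₁ ++ A₂).flatten) := by simp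
      obtain ⟨m', A', D, hAm, -, -, hDm, hDA, -, hD⟩ := hA.exists_tail hf
      obtain ⟨hm', rfl⟩ := List.cons.inj hAm
      obtain rfl := (List.cons.inj hm').2
      subst hDm
      replace hDA : IsCanonical (D ++ A₁ ++ A₂) := by rwa [List.append_assoc]
      have key := ih (D ++ A₁).flatten.length (by simp at hN ⊢; omega) hDA
        (fun a ha b' hb' => ?_) rfl
      · have hzero : (if j = i then
            shw n (i :: (D ++ A₁ ++ A₂).flatten) (b ++ B.flatten) (D ++ A₁ ++ C).flatten
              else 0) = 0 := by
          refine ite_eq_right_iff.2 fun hji => ?_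
          by_contra h
          have := (shw_ne_zero h).symm.cons_lt_flatten (i := j) hB hA hAC (by simp) (by simp)
            (by
              refine List.Perm.trans ?_ List.perm_append_comm
              rw [List.append_assoc]
              exact p.append_left _)
            (v := i :: D.flatten) (by simp) (hlt _ (by simp) _ (by simp))
          simp [hji] at this
        have e₁ : (((i :: D.flatten) :: A₁ ++ A₂).flatten) = i :: (D ++ A₁ ++ A₂).flatten := by
          simp
        have e₂ : (((i :: D.flatten) :: A₁ ++ C).flatten) = i :: (D ++ A₁ ++ C).flatten := by
          simp
        have e₃ : ((j :: b) :: B).flatten = j :: (b ++ B.flatten) := by simp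
        have e₄ : ((i :: D.flatten) :: A₁).flatten = i :: (D ++ A₁).flatten := by simp
        rw [e₃] at key ⊢
        rw [e₁, e₂, e₄, shw_cons_cons, Finsupp.add_apply, Finsupp.smul_apply, consMap_apply_cons,
          consMap_apply_cons, hzero, if_pos rfl, key, smul_eq_mul, add_zero,
          chi_cons_left n i (D ++ A₁).flatten, mul_assoc]
      · rcases List.mem_append.1 ha with ha | ha
        · exact (hlt _ (by simp) b' hb').trans (hD a ha)
        · exact hlt a (by simp [ha]) b' hb'

/-- Dominating Lyndon factors on the right of a shuffle must be read first. -/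
theorem shw_flatten_right {n : ℕ} {A B₁ B₂ C : List (List (Fin (n+2)))}
    (hA : IsCanonical A) (hB : IsCanonical (B₁ ++ B₂)) (hC : IsCanonical C)
    (p : C.Perm (B₂ ++ A)) (hlt : ∀ b ∈ B₁, ∀ a ∈ A, a < b) :
    shw n A.flatten (B₁ ++ B₂).flatten (B₁ ++ C).flatten
      = shw n A.flatten B₂.flatten C.flatten := by
  induction hN : B₁.flatten.length using Nat.strong_induction_on generalizing B₁ with
  | _ N ih =>
  cases B₁ with
  | nil => simp
  | cons m B₁ =>
    have hBC := hB.append_of_perm hC p hlt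
    cases A with
    | nil =>
      obtain rfl : C = B₂ := hC.eq_of_perm (isCanonical_append.1 hB).2.1 (by simpa using p)
      simp
    | cons a A =>
      obtain ⟨ha, -, -⟩ := isCanonical_cons.1 hA
      obtain ⟨j, m, rfl⟩ := List.exists_cons_of_ne_nil (hB.1 m (by simp)).1
      obtain ⟨i, a, rfl⟩ := List.exists_cons_of_ne_nil ha.1
      have hf : ((j :: m) :: B₁ ++ B₂).flatten = j :: (m ++ (B₁ ++ B₂).flatten) := by simp
      obtain ⟨m', B', D, hBm, -, -, hDm, hDB, -, hD⟩ := hB.exists_tail hf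
      obtain ⟨hm', rfl⟩ := List.cons.inj hBm
      obtain rfl := (List.cons.inj hm').2
      subst hDm
      replace hDB : IsCanonical (D ++ B₁ ++ B₂) := by rwa [List.append_assoc]
      have key := ih (D ++ B₁).flatten.length (by simp at hN ⊢; omega) hDB
        (fun b hb a' ha' => ?_) rfl
      · have hzero : (if i = j then
            shw n (a ++ A.flatten) (j :: (D ++ B₁ ++ B₂).flatten) (D ++ B₁ ++ C).flatten
              else 0) = 0 := by
          refine ite_eq_right_iff.2 fun hij => ?_
          by_contra h
          have := (shw_ne_zero h).cons_lt_flatten (i := i) hA hB hBC (by simp) (by simp)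
            (by
              refine List.Perm.trans ?_ List.perm_append_comm
              rw [List.append_assoc]
              exact p.append_left _)
            (v := j :: D.flatten) (by simp) (hlt _ (by simp) _ (by simp))
          simp [hij] at this
        have e₁ : (((j :: D.flatten) :: B₁ ++ B₂).flatten) = j :: (D ++ B₁ ++ B₂).flatten := by
          simp
        have e₂ : (((j :: D.flatten) :: B₁ ++ C).flatten) = j :: (D ++ B₁ ++ C).flatten := by
          simp
        have e₃ : ((i :: a) :: A).flatten = i :: (a ++ A.flatten) := by simp
        rw [e₃] at key ⊢
        rw [e₁, e₂, shw_cons_cons, Finsupp.add_apply, Finsupp.smul_apply, consMap_apply_cons,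
          consMap_apply_cons, hzero, if_pos rfl, key, smul_zero, zero_add]
      · rcases List.mem_append.1 hb with hb | hb
        · exact (hlt _ (by simp) a' ha').trans (hD b hb)
        · exact hlt b (by simp [hb]) a' ha'

theorem shw_flatten_append {n : ℕ} {A B : List (List (Fin (n+2)))}
    (hA : IsCanonical A) (hB : IsCanonical B) (hlt : ∀ b ∈ B, ∀ a ∈ A, a < b) :
    shw n A.flatten B.flatten (B ++ A).flatten = 1 := by
  simpa using shw_flatten_right (B₂ := []) hA (by simpa using hB) hA (by simp) hlt

theorem isCanonical_replicate {α : Type*} [LinearOrder α] {l : List α} (hl : IsLyndon l) (k : ℕ) :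
    IsCanonical (List.replicate k l) :=
  ⟨fun a ha => by rwa [List.eq_of_mem_replicate ha], List.pairwise_replicate.2 (.inr le_rfl)⟩

theorem rep_succ (n m : ℕ) (l : List (Fin (n+2))) : rep n (m + 1) l = l ++ rep n m l := by
  simp [rep, List.replicate_succ]

theorem shw_rep_self {n : ℕ} {l : List (Fin (n+2))} (hl : IsLyndon l) (k : ℕ) :
    shw n (rep n k l) l (rep n (k + 1) l) = ∑ j ∈ Finset.range (k + 1), chi n l l ^ j := by
  induction k with
  | zero => simp [rep]
  | succ k ih =>
    obtain ⟨i, m, rfl⟩ := List.exists_cons_of_ne_nil hl.1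
    obtain ⟨D, hD, rfl⟩ := exists_isCanonical_flatten m
    have hlt := hl.lt_of_mem_tail hD rfl
    have h₁ := shw_flatten_left (n := n) (A₁ := D) (A₂ := List.replicate k (i :: D.flatten))
      (B := [i :: D.flatten]) (C := List.replicate (k + 1) (i :: D.flatten))
      (isCanonical_append.2 ⟨hD, isCanonical_replicate hl k, fun a ha b hb => by
        rw [List.eq_of_mem_replicate hb]; exact (hlt a ha).le⟩)
      (isCanonical_replicate hl 1) (isCanonical_replicate hl _)
      (by rw [List.replicate_succ']) (by simpa using hlt)
    have h₂ := shw_flatten_append (n := n) (A := List.replicate (k + 1) (i :: D.flatten)) (B := D)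
      (isCanonical_replicate hl _) hD (fun b hb a ha => by
        rw [List.eq_of_mem_replicate ha]; exact hlt b hb)
    simp only [List.flatten_append, List.flatten_singleton] at h₁ h₂
    rw [rep_succ n (k + 1), geom_sum_succ, ← ih]
    nth_rewrite 1 [rep_succ n k]
    rw [List.cons_append, List.cons_append, shw_cons_cons, Finsupp.add_apply, Finsupp.smul_apply,
      consMap_apply_cons, consMap_apply_cons, if_pos rfl, if_pos rfl, ← List.cons_append,
      ← rep_succ]
    simp only [rep]
    rw [h₁, h₂, smul_eq_mul, ← mul_assoc, ← chi_cons_left]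

theorem shPow_leading {n : ℕ} {l : List (Fin (n+2))} (hl : IsLyndon l) (m : ℕ) :
    BoundedBy n (shPow n l m) (rep n m l) ∧ shPow n l m (rep n m l)
      = ∏ r ∈ Finset.range m, ∑ j ∈ Finset.range (r + 1), chi n l l ^ j := by
  induction m with
  | zero => exact ⟨boundedBy_single n [], by simp [shPow, rep]⟩
  | succ m ih =>
    have h := ih.1.diam (boundedBy_single n l) (T := rep n (m + 1) l)
      (fun z hz => hz.le_flatten (isCanonical_replicate hl m) (isCanonical_replicate hl 1)
        (isCanonical_replicate hl (m + 1)) rfl (by simp) (by rw [List.replicate_succ']; rfl))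
      (by rw [rep_succ, List.length_append, add_comm])
    refine ⟨h.1, h.2.trans ?_⟩
    rw [ih.2, shw_rep_self hl, Finset.prod_range_succ]
    simp

/-- The list of Lyndon factors, with multiplicities, recorded by a factorization. -/
def factorList (n : ℕ) (fs : List (List (Fin (n+2)) × ℕ)) : List (List (Fin (n+2))) :=
  (fs.map fun p => List.replicate p.2 p.1).flatten

theorem flatten_factorList (n : ℕ) (fs : List (List (Fin (n+2)) × ℕ)) :
    (factorList n fs).flatten = wordOfFac n fs := by
  simp [factorList, wordOfFac, rep, List.flatten_flatten, Function.comp_def]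

theorem exists_mem_of_mem_factorList {n : ℕ} {fs : List (List (Fin (n+2)) × ℕ)}
    {a : List (Fin (n+2))} (ha : a ∈ factorList n fs) : ∃ p ∈ fs, a = p.1 := by
  obtain ⟨l, hl, hal⟩ := List.mem_flatten.1 ha
  obtain ⟨p, hp, rfl⟩ := List.mem_map.1 hl
  exact ⟨p, hp, List.eq_of_mem_replicate hal⟩

theorem factorList_cons (n : ℕ) (p : List (Fin (n+2)) × ℕ) (fs : List (List (Fin (n+2)) × ℕ)) :
    factorList n (p :: fs) = List.replicate p.2 p.1 ++ factorList n fs := by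
  simp [factorList]

theorem isCanonical_factorList {n : ℕ} {fs : List (List (Fin (n+2)) × ℕ)}
    (hl : ∀ p ∈ fs, IsLyndon p.1) (hs : fs.Pairwise fun a b => b.1 < a.1) :
    IsCanonical (factorList n fs) := by
  induction fs with
  | nil => exact .nil
  | cons p fs ih =>
    obtain ⟨hp, hs⟩ := List.pairwise_cons.1 hs
    rw [factorList_cons]
    refine isCanonical_append.2 ⟨isCanonical_replicate (hl p (by simp)) _,
      ih (fun q hq => hl q (by simp [hq])) hs, fun a ha b hb => ?_⟩
    obtain ⟨q, hq, rfl⟩ := exists_mem_of_mem_factorList hb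
    rw [List.eq_of_mem_replicate ha]
    exact (hp q hq).le

theorem bigSh_leading {n : ℕ} {fs : List (List (Fin (n+2)) × ℕ)}
    (hl : ∀ p ∈ fs, IsLyndon p.1) (hs : fs.Pairwise fun a b => b.1 < a.1) :
    BoundedBy n (bigSh n fs) (wordOfFac n fs) ∧ bigSh n fs (wordOfFac n fs)
      = (fs.map fun p => shPow n p.1 p.2 (rep n p.2 p.1)).prod := by
  induction fs with
  | nil => exact ⟨boundedBy_single n [], by simp [bigSh, wordOfFac]⟩
  | cons p fs ih =>
    have hcan := isCanonical_factorList hl hs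
    obtain ⟨hp, hs⟩ := List.pairwise_cons.1 hs
    have hl' : ∀ q ∈ fs, IsLyndon q.1 := fun q hq => hl q (by simp [hq])
    have hpl := hl p (by simp)
    have hcan' := isCanonical_factorList hl' hs
    have e : wordOfFac n (p :: fs) = rep n p.2 p.1 ++ wordOfFac n fs := by simp [wordOfFac]
    have h := (ih hl' hs).1.diam (shPow_leading hpl p.2).1 (T := wordOfFac n (p :: fs))
      (fun z hz => by
        rw [← flatten_factorList]
        refine hz.le_flatten hcan' (isCanonical_replicate hpl p.2) hcan
          (flatten_factorList n fs) rfl ?_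
        rw [factorList_cons]
        exact List.perm_append_comm)
      (by rw [e, List.length_append, add_comm])
    have h₁ := shw_flatten_append hcan' (isCanonical_replicate hpl p.2) (fun b hb a ha => by
      obtain ⟨q, hq, rfl⟩ := exists_mem_of_mem_factorList ha
      rw [List.eq_of_mem_replicate hb]
      exact hp q hq)
    rw [List.flatten_append, flatten_factorList] at h₁
    refine ⟨h.1, h.2.trans ?_⟩
    rw [(ih hl' hs).2, e]
    change _ * _ * shw n (wordOfFac n fs) (List.replicate p.2 p.1).flatten
      ((List.replicate p.2 p.1).flatten ++ wordOfFac n fs) = _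
    rw [h₁, mul_one, mul_comm, List.map_cons, List.prod_cons]

/-- Coordinates of the simple roots in an orthogonal basis. -/
def rootCoord (n : ℕ) (i k : Fin (n+2)) : ℤ :=
  (if i = k then 1 else 0) - if (i : ℕ) + 1 = k then 1 else 0

theorem cart_eq_sum (n : ℕ) (i j : Fin (n+2)) :
    cart n i j = 2 * ∑ k, rootCoord n i k * rootCoord n j k := by
  have h₁ : ∑ k : Fin (n+2), (if i = k then 1 else 0) * rootCoord n j k = rootCoord n j i := by
    simp
  have h₂ : ∑ k : Fin (n+2), (if (i : ℕ) + 1 = k then 1 else 0) * rootCoord n j k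
      = if h : (i : ℕ) + 1 < n + 2 then rootCoord n j ⟨i + 1, h⟩ else 0 := by
    split_ifs with h
    · rw [Finset.sum_eq_single ⟨i + 1, h⟩]
      · simp
      · intro k _ hk
        rw [if_neg fun h' => hk (Fin.ext h'.symm), zero_mul]
      · simp
    · refine Finset.sum_eq_zero fun k _ => ?_
      rw [if_neg (by omega), zero_mul]
  have h₃ : ∑ k, rootCoord n i k * rootCoord n j k = rootCoord n j i
      - if h : (i : ℕ) + 1 < n + 2 then rootCoord n j ⟨i + 1, h⟩ else 0 := by
    rw [← h₁, ← h₂, ← Finset.sum_sub_distrib]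
    exact Finset.sum_congr rfl fun k _ => by rw [← sub_mul]; rfl
  rw [h₃, cart]
  have := i.isLt
  have := j.isLt
  simp only [rootCoord, Fin.ext_iff]
  split_ifs <;> omega

theorem bil_self_eq (n : ℕ) (μ : Fin (n+2) → ℕ) :
    bil n μ μ = 2 * ∑ k, (∑ i, (μ i : ℤ) * rootCoord n i k) ^ 2 := by
  simp only [bil, cart_eq_sum, sq, Finset.sum_mul_sum]
  simp only [Finset.mul_sum]
  symm
  rw [Finset.sum_comm]
  refine Finset.sum_congr rfl fun i _ => ?_
  rw [Finset.sum_comm]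
  refine Finset.sum_congr rfl fun j _ => Finset.sum_congr rfl fun k _ => ?_
  ring

theorem bil_self_pos (n : ℕ) (μ : Fin (n+2) → ℕ) (hμ : ∃ i, μ i ≠ 0) : 0 < bil n μ μ := by
  rw [bil_self_eq]
  by_contra hneg
  have hnn : ∀ k ∈ Finset.univ, 0 ≤ (∑ i, (μ i : ℤ) * rootCoord n i k) ^ 2 :=
    fun k _ => sq_nonneg _
  have hzero : ∑ k, (∑ i, (μ i : ℤ) * rootCoord n i k) ^ 2 = 0 :=
    le_antisymm (by linarith) (Finset.sum_nonneg hnn)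
  have hk : ∀ k : Fin (n+2), ∑ i, (μ i : ℤ) * rootCoord n i k = 0 := fun k =>
    pow_eq_zero_iff (two_ne_zero) |>.1 ((Finset.sum_eq_zero_iff_of_nonneg hnn).1 hzero k
      (Finset.mem_univ k))
  have hall : ∀ m (h : m < n + 2), μ ⟨m, h⟩ = 0 := by
    intro m
    induction m with
    | zero =>
      intro h
      have := hk ⟨0, h⟩
      simp only [rootCoord] at this
      rw [Finset.sum_eq_single (⟨0, h⟩ : Fin (n + 2))
          (by intro b _ hb; rw [if_neg hb, if_neg (by simp), sub_zero, mul_zero])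
          (by simp)] at this
      simpa using this
    | succ m ih =>
      intro h
      have hm := ih (by omega)
      have := hk ⟨m + 1, h⟩
      simp only [rootCoord, mul_sub, Finset.sum_sub_distrib] at this
      rw [Finset.sum_eq_single (⟨m + 1, h⟩ : Fin (n+2)) (by simp +contextual) (by simp),
        Finset.sum_eq_single (⟨m, by omega⟩ : Fin (n+2))
          (by intro b _ hb; rw [if_neg fun h' => hb (Fin.ext (by simpa using h')), mul_zero])
          (by simp), hm] at this
      simpa using this
  obtain ⟨i, hi⟩ := hμ
  exact hi (hall i i.isLt)

theorem two_dvd_bil_self (n : ℕ) (μ : Fin (n+2) → ℕ) : 2 ∣ bil n μ μ :=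
  ⟨_, bil_self_eq n μ⟩

theorem qX_zpow_ne_one {k : ℤ} (hk : k ≠ 0) : qX ^ k ≠ 1 := by
  have hnat : ∀ m : ℕ, m ≠ 0 → qX ^ m ≠ 1 := by
    intro m hm h
    have h' : algebraMap (Polynomial ℚ) Kq (Polynomial.X ^ m) = algebraMap (Polynomial ℚ) Kq 1 := by
      simpa [qX] using h
    have := congrArg Polynomial.natDegree (RatFunc.algebraMap_injective ℚ h')
    simp [hm] at this
  rcases Int.natAbs_eq k with h | h
  · rw [h, zpow_natCast]
    exact hnat _ (by omega)
  · rw [h, zpow_neg, zpow_natCast]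
    exact fun h' => hnat _ (by omega) (inv_eq_one.1 h')

theorem qI_ne_zero (n : ℕ) (l : List (Fin (n+2))) : qI n l ≠ 0 := zpow_ne_zero _ qX_ne_zero

theorem chi_self_eq (n : ℕ) (l : List (Fin (n+2))) :
    chi n l l = (-1) ^ pw n l * (qI n l)⁻¹ ^ 2 := by
  have h₁ : (-1 : Kq) ^ (pw n l * pw n l) = (-1) ^ pw n l := by
    rcases Nat.even_or_odd (pw n l) with h | h
    · rw [(h.mul_left _).neg_one_pow, h.neg_one_pow]
    · rw [(h.mul h).neg_one_pow, h.neg_one_pow]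
  have h₂ : -bil n (wt n l) (wt n l) = -(bil n (wt n l) (wt n l) / 2) * (2 : ℕ) := by
    have := two_dvd_bil_self n (wt n l)
    omega
  rw [chi, h₁, qI, h₂, zpow_mul, zpow_neg, zpow_natCast]

theorem chi_self_pow_ne_one (n : ℕ) {l : List (Fin (n+2))} (hl : l ≠ []) {r : ℕ} (hr : r ≠ 0) :
    chi n l l ^ r ≠ 1 := by
  intro h
  have hpos : 0 < bil n (wt n l) (wt n l) := by
    refine bil_self_pos n _ ⟨l.head hl, ?_⟩
    exact (List.count_pos_iff.2 (List.head_mem hl)).ne'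
  have h₂ : (chi n l l ^ r) ^ 2 = 1 := by rw [h, one_pow]
  have hsq : ∀ k : ℕ, (((-1 : Kq) ^ k) ^ r) ^ 2 = 1 := fun k => by
    rw [← pow_mul, ← pow_mul, Even.neg_one_pow (by simp)]
  rw [chi, mul_pow, mul_pow, hsq, one_mul, ← zpow_natCast, ← zpow_natCast, ← zpow_mul,
    ← zpow_mul] at h₂
  refine qX_zpow_ne_one ?_ h₂
  simp [hr, hpos.ne']

theorem geom_sum_chi_ne_zero (n : ℕ) {l : List (Fin (n+2))} (hl : l ≠ []) (r : ℕ) :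
    ∑ j ∈ Finset.range (r + 1), chi n l l ^ j ≠ 0 := by
  intro h
  have := geom_sum_mul (chi n l l) (r + 1)
  rw [h, zero_mul] at this
  exact chi_self_pow_ne_one n hl r.succ_ne_zero (sub_eq_zero.1 this.symm)

theorem qint_eq (n : ℕ) (l : List (Fin (n+2))) (m : ℕ) :
    qint n l m = (((-1) ^ pw n l * qI n l) ^ m - (qI n l)⁻¹ ^ m)
      / ((-1) ^ pw n l * qI n l - (qI n l)⁻¹) := by
  rw [qint]
  split_ifs with h
  · simp [(Nat.even_iff.2 h).neg_one_pow]
  · simp [(Nat.not_even_iff_odd.1 fun h' => h (Nat.even_iff.1 h')).neg_one_pow]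

theorem geom_sum_chi_eq (n : ℕ) {l : List (Fin (n+2))} (hl : l ≠ []) (m : ℕ) :
    ∑ j ∈ Finset.range (m + 1), chi n l l ^ j
      = (-1) ^ (pw n l * m) * (qI n l)⁻¹ ^ m * qint n l (m + 1) := by
  have h1 := chi_self_pow_ne_one n hl one_ne_zero
  rw [pow_one] at h1
  have hQ := qI_ne_zero n l
  have hQP : qI n l * (qI n l)⁻¹ = 1 := mul_inv_cancel₀ hQ
  have hε : ((-1 : Kq) ^ pw n l) * (-1) ^ pw n l = 1 := by
    rw [← mul_pow]; simp
  rw [geom_sum_eq h1, qint_eq, pow_mul]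
  rw [chi_self_eq] at h1 ⊢
  generalize (-1 : Kq) ^ pw n l = ε at *
  generalize (qI n l)⁻¹ = P at *
  generalize qI n l = Q at *
  have hden : ε * Q - P ≠ 0 := by
    intro h
    apply h1
    linear_combination (-ε * P) * h + ε * ε * hQP + hε
  have hεm : ε ^ m * ε ^ m = 1 := by rw [← mul_pow, hε, one_pow]
  have hm : Q ^ m * P ^ m = 1 := by rw [← mul_pow, hQP, one_pow]
  rw [← mul_div_assoc, div_eq_div_iff (sub_ne_zero.2 h1) hden]
  simp only [mul_pow, pow_succ, pow_zero, one_mul]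
  linear_combination (ε ^ m * (P ^ m) ^ 2 * P ^ 2 * Q - Q * P ^ 2) * hε
    + (ε ^ m * (P ^ m) ^ 2 * P - P) * hQP
    - (ε * ε * Q * P ^ 2 - ε * Q) * (Q ^ m * P ^ m * hεm + hm)

theorem qfact_eq (n : ℕ) {l : List (Fin (n+2))} (hl : l ≠ []) (m : ℕ) :
    ∏ r ∈ Finset.range m, ∑ j ∈ Finset.range (r + 1), chi n l l ^ j
      = (-1) ^ (pw n l * (m * (m - 1) / 2))
        * qX ^ (-(bil n (wt n l) (wt n l) / 2 * ((m * (m - 1) / 2 : ℕ) : ℤ))) * qfact n l m := by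
  induction m with
  | zero => simp [qfact]
  | succ m ih =>
    rw [Finset.prod_range_succ, ih, geom_sum_chi_eq n hl, Nat.triangle_succ, qfact, Nat.cast_add, mul_add, mul_add,
      neg_add, zpow_add₀ qX_ne_zero, pow_add, qI, ← zpow_neg, ← zpow_natCast (qX ^ _), ← zpow_mul,
      neg_mul]
    ring

theorem prod_shPow_eq {n : ℕ} {fs : List (List (Fin (n+2)) × ℕ)} (hl : ∀ p ∈ fs, IsLyndon p.1) :
    (fs.map fun p => shPow n p.1 p.2 (rep n p.2 p.1)).prod
      = (-1 : Kq) ^ (xiFac n fs) * qX ^ (-(sFac n fs)) * facProd n fs := by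
  induction fs with
  | nil => simp [xiFac, sFac, facProd]
  | cons p fs ih =>
    have hp := hl p (by simp)
    have hx : xiFac n (p :: fs) = pw n p.1 * (p.2 * (p.2 - 1) / 2) + xiFac n fs := by
      simp [xiFac]
    have hs : sFac n (p :: fs) = bil n (wt n p.1) (wt n p.1) / 2
        * ((p.2 * (p.2 - 1) / 2 : ℕ) : ℤ) + sFac n fs := by
      simp [sFac]
    have hf : facProd n (p :: fs) = qfact n p.1 p.2 * facProd n fs := by
      simp [facProd]
    rw [List.map_cons, List.prod_cons, ih fun q hq => hl q (by simp [hq]),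
      (shPow_leading hp p.2).2, qfact_eq n hp.1, hx, hs, hf, pow_add, neg_add,
      zpow_add₀ qX_ne_zero]
    ring

/-- Let `𝐢` be a dominant word with canonical factorization
`𝐢 = 𝐢₁^{n₁} ⋯ 𝐢_d^{n_d}` (with `𝐢₁ ≻ ⋯ ≻ 𝐢_d` dominant Lyndon words and all
`n_k > 0`).  Then
`𝐢_d^{⋄n_d} ⋄ ⋯ ⋄ 𝐢₁^{⋄n₁} = (-1)^{ξ(𝐢)} q^{-s(𝐢)} (∏_k [n_k]_{𝐢_k}!) · 𝐢 + Σ_{𝐤 ≺ 𝐢} a_𝐤 𝐤`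
with coefficients `a_𝐤 ∈ ℤ[q,q⁻¹]`; in particular the maximal word of the left-hand
side is `𝐢` and its coefficient there is `(-1)^{ξ(𝐢)} q^{-s(𝐢)} ∏_k [n_k]_{𝐢_k}!`. -/
theorem stmt14 (n : ℕ) (fs : List (List (Fin (n+2)) × ℕ))
    (hfac : ∀ p ∈ fs, (IsDominant n p.1 ∧ IsLyndonW n p.1) ∧ 0 < p.2)
    (hsort : fs.Chain' (fun a b => wlt n b.1 a.1)) :
    IsMaxWord n (bigSh n fs) (wordOfFac n fs) ∧
    (bigSh n fs) (wordOfFac n fs)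
      = (-1 : Kq) ^ (xiFac n fs) * qX ^ (-(sFac n fs)) * facProd n fs ∧
    ∀ w : List (Fin (n+2)), w ≠ wordOfFac n fs → (bigSh n fs) w ∈ LaurentSub := by
  have hl : ∀ p ∈ fs, IsLyndon p.1 := fun p hp => (hfac p hp).1.2
  have hs : fs.Pairwise fun a b => b.1 < a.1 :=
    haveI : IsTrans (List (Fin (n+2)) × ℕ) fun a b => b.1 < a.1 := ⟨fun _ _ _ h₁ h₂ => h₂.trans h₁⟩
    List.isChain_iff_pairwise.1 hsort
  obtain ⟨hb, hc⟩ := bigSh_leading hl hs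
  have hterm : ∀ p ∈ fs, shPow n p.1 p.2 (rep n p.2 p.1) ≠ 0 := fun p hp => by
    rw [(shPow_leading (hl p hp) p.2).2]
    exact Finset.prod_ne_zero_iff.2 fun r _ => geom_sum_chi_ne_zero n (hl p hp).1 r
  refine ⟨⟨?_, fun v hv => ?_⟩, ?_, fun w _ => bigSh_mem n fs w⟩
  · rw [Finsupp.mem_support_iff, hc]
    refine List.prod_ne_zero fun h => ?_
    obtain ⟨p, hp, h⟩ := List.mem_map.1 h
    exact hterm p hp h
  · exact (hb v (Finsupp.mem_support_iff.1 hv)).2.eq_or_lt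
  · rw [hc]
    exact prod_shPow_eq fun p hp => hl p hp

end SpinQHA
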